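/- Let L be a finite-dimensional n-Lie algebra, let U be a subnormal subalgebra of L, and let K be an ideal of U with K ⊆ Φ(L). If the quotient U/K is nilpotent, then U is nilpotent. -/

import Mathlib

namespace NLie

open Finset

variable {F : Type*} [Field F] {L : Type*} [AddCommGroup L] [Module F L] {n : ℕ}

/-- The generalized Jacobi identity for an `(n+2)`-ary alternating bracket:
`[y₁,…,y_{n+1},[x₁,…,x_{n+2}]] = ∑ᵢ [x₁,…,[y₁,…,y_{n+1},xᵢ],…,x_{n+2}]`.
(This is the identity (1) of the paper, rewritten with the string `y` in the
first `n+1` slots, which is equivalent since the bracket is alternating.) -/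
def IsNLie (f : AlternatingMap F L L (Fin (n + 2))) : Prop :=
  ∀ (y : Fin (n + 1) → L) (x : Fin (n + 2) → L),
    f (Fin.snoc y (f x)) = ∑ i, f (Function.update x i (f (Fin.snoc y (x i))))

/-- `d : L → L` is a derivation of the bracket `f`. -/
def IsDerivation (f : AlternatingMap F L L (Fin (n + 2))) (d : L →ₗ[F] L) : Prop :=
  ∀ x : Fin (n + 2) → L, d (f x) = ∑ i, f (Function.update x i (d (x i)))

/-- The (inner) derivation `D(a₁,…,a_{n+1}) : x ↦ [a₁,…,a_{n+1},x]`. -/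
def D (f : AlternatingMap F L L (Fin (n + 2))) (a : Fin (n + 1) → L) : L →ₗ[F] L where
  toFun x := f (Fin.snoc a x)
  map_add' x y := by
    have h := f.toMultilinearMap.map_update_add (Fin.snoc a x) (Fin.last (n + 1)) x y
    simpa [Fin.update_snoc_last] using h
  map_smul' c x := by
    have h := f.toMultilinearMap.map_update_smul (Fin.snoc a x) (Fin.last (n + 1)) c x
    simpa [Fin.update_snoc_last] using h

/-- `D(U)`: the span of all inner derivations `D(a₁,…,a_{n+1})` with all `aᵢ ∈ U`. -/
def Dspan (f : AlternatingMap F L L (Fin (n + 2))) (U : Submodule F L) :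
    Submodule F (L →ₗ[F] L) :=
  Submodule.span F {d | ∃ a : Fin (n + 1) → L, (∀ i, a i ∈ U) ∧ d = D f a}

/-- The Engel subspace `E_L(d) = {x ∈ L ∣ dʳ x = 0 for some r}`. -/
def engel (d : L →ₗ[F] L) : Submodule F L where
  carrier := {x | ∃ r, (d ^ r) x = 0}
  zero_mem' := ⟨0, map_zero _⟩
  add_mem' := by
    rintro a b ⟨r, hr⟩ ⟨s, hs⟩
    refine ⟨r + s, ?_⟩
    have h1 : (d ^ (r + s)) a = (d ^ s) ((d ^ r) a) := by
      rw [add_comm r s, pow_add]; rfl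
    have h2 : (d ^ (r + s)) b = (d ^ r) ((d ^ s) b) := by
      rw [pow_add]; rfl
    rw [map_add, h1, h2, hr, hs, map_zero, map_zero, add_zero]
  smul_mem' := by
    rintro c a ⟨r, hr⟩
    exact ⟨r, by rw [map_smul, hr, smul_zero]⟩

/-- `E` is an Engel subalgebra of `L`: `E = E_L(d)` for some inner derivation `d ∈ D(E)`. -/
def IsEngel (f : AlternatingMap F L L (Fin (n + 2))) (E : Submodule F L) : Prop :=
  ∃ d : L →ₗ[F] L, d ∈ Dspan f E ∧ E = engel d

/-- `[A₁,…,A_{n+2}]`: the subspace spanned by all brackets with `aᵢ ∈ Aᵢ`. -/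
def bracketSpan (f : AlternatingMap F L L (Fin (n + 2))) (A : Fin (n + 2) → Submodule F L) :
    Submodule F L :=
  Submodule.span F {z | ∃ a : Fin (n + 2) → L, (∀ i, a i ∈ A i) ∧ f a = z}

/-- `K` is a subalgebra of `L`. -/
def IsSubalg (f : AlternatingMap F L L (Fin (n + 2))) (K : Submodule F L) : Prop :=
  ∀ a : Fin (n + 2) → L, (∀ i, a i ∈ K) → f a ∈ K

/-- `K` is an ideal of `L` : `[K,L,…,L] ⊆ K`. -/
def IsIdeal (f : AlternatingMap F L L (Fin (n + 2))) (K : Submodule F L) : Prop :=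
  ∀ a : Fin (n + 2) → L, a 0 ∈ K → f a ∈ K

/-- `V` is an ideal of the subalgebra `W`. -/
def IsIdealIn (f : AlternatingMap F L L (Fin (n + 2))) (V W : Submodule F L) : Prop :=
  V ≤ W ∧ ∀ a : Fin (n + 2) → L, a 0 ∈ V → (∀ i, a i ∈ W) → f a ∈ V

/-- `M` is a maximal proper subalgebra of `L`. -/
def IsMaximalSubalg (f : AlternatingMap F L L (Fin (n + 2))) (M : Submodule F L) : Prop :=
  IsSubalg f M ∧ M ≠ ⊤ ∧ ∀ U : Submodule F L, IsSubalg f U → M < U → U = ⊤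

/-- The Frattini subalgebra: the intersection of all maximal proper subalgebras. -/
def frattini (f : AlternatingMap F L L (Fin (n + 2))) : Submodule F L :=
  sInf {M | IsMaximalSubalg f M}

/-- The lower central series of a subalgebra `U`:
`U¹ = U`, `U^{s+1} = [Uˢ, U,…,U]`. (`lcsIn f U s` is `U^{s+1}`.) -/
def lcsIn (f : AlternatingMap F L L (Fin (n + 2))) (U : Submodule F L) : ℕ → Submodule F L
  | 0 => U
  | s + 1 => bracketSpan f (Fin.cons (lcsIn f U s) fun _ => U)

/-- `L` is a nilpotent `(n+2)`-Lie algebra. -/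
def IsNilpotentAlg (f : AlternatingMap F L L (Fin (n + 2))) : Prop :=
  ∃ r, lcsIn f ⊤ r = ⊥

/-- The lower central series of `U` modulo `K`: `U/K` is nilpotent iff some term
of this series is contained in `K`. -/
def lcsMod (f : AlternatingMap F L L (Fin (n + 2))) (U K : Submodule F L) : ℕ → Submodule F L
  | 0 => U
  | s + 1 => bracketSpan f (Fin.cons (lcsMod f U K s) fun _ => U) ⊔ K

/-- The series `K¹ = K`, `K^{s+1} = [Kˢ, K, L,…,L]` used to define
"2-nilpotently embedded". -/
def nes2 (f : AlternatingMap F L L (Fin (n + 2))) (K : Submodule F L) : ℕ → Submodule F L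
  | 0 => K
  | s + 1 => bracketSpan f (Fin.cons (nes2 f K s) (Fin.cons K fun _ => ⊤))

/-- The series of `B` modulo `A`, so that `B/A` is 2-nilpotently embedded in `L/A`
iff some term of this series is contained in `A`. -/
def nes2Mod (f : AlternatingMap F L L (Fin (n + 2))) (B A : Submodule F L) : ℕ → Submodule F L
  | 0 => B
  | s + 1 => bracketSpan f (Fin.cons (nes2Mod f B A s) (Fin.cons B fun _ => ⊤)) ⊔ A

/-- The 2-derived series: `L⁽⁰⁾ = L`, `L⁽ˢ⁺¹⁾ = [L⁽ˢ⁾, L⁽ˢ⁾, L,…,L]`. -/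
def ds2 (f : AlternatingMap F L L (Fin (n + 2))) : ℕ → Submodule F L
  | 0 => ⊤
  | s + 1 => bracketSpan f (Fin.cons (ds2 f s) (Fin.cons (ds2 f s) fun _ => ⊤))

/-- `L` is 2-soluble. -/
def Is2Soluble (f : AlternatingMap F L L (Fin (n + 2))) : Prop :=
  ∃ r, ds2 f r = ⊥

/-- The `k`-derived series of an ideal `K`:
`K⁽⁰⁾ = K`, `K⁽ˢ⁺¹⁾ = [(k)K⁽ˢ⁾, (n+2-k)L]`: `K` is `k`-solubly embedded in `L`
iff some term vanishes. -/
def dsk (f : AlternatingMap F L L (Fin (n + 2))) (k : ℕ) (K : Submodule F L) :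
    ℕ → Submodule F L
  | 0 => K
  | s + 1 => bracketSpan f (fun i => if (i : ℕ) < k then dsk f k K s else ⊤)

/-- The `k`-derived series of `A` modulo `B`: `A/B` is `k`-solubly embedded in `L/B`
iff some term of this series is contained in `B`. -/
def dskMod (f : AlternatingMap F L L (Fin (n + 2))) (k : ℕ) (A B : Submodule F L) :
    ℕ → Submodule F L
  | 0 => A
  | s + 1 => bracketSpan f (fun i => if (i : ℕ) < k then dskMod f k A B s else ⊤) ⊔ B

/-- The ideal `A` is abelian embedded in `L`: `[A,A,L,…,L] = 0`. -/
def IsAbelianEmbedded (f : AlternatingMap F L L (Fin (n + 2))) (A : Submodule F L) : Prop :=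
  ∀ a : Fin (n + 2) → L, a 0 ∈ A → a 1 ∈ A → f a = 0

/-- `A` is a minimal abelian embedded ideal of `L`: a nonzero abelian embedded ideal
whose only properly contained ideal is `0`. -/
def IsMinAbelianEmbeddedIdeal (f : AlternatingMap F L L (Fin (n + 2)))
    (A : Submodule F L) : Prop :=
  A ≠ ⊥ ∧ IsIdeal f A ∧ IsAbelianEmbedded f A ∧
    ∀ B : Submodule F L, IsIdeal f B → B < A → B = ⊥

/-- The normalizer `N_L(U) = {x ∈ L ∣ [x,u₁,…,u_{n+1}] ∈ U for all uᵢ ∈ U}`. -/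
def normalizer (f : AlternatingMap F L L (Fin (n + 2))) (U : Submodule F L) : Set L :=
  {x | ∀ u : Fin (n + 1) → L, (∀ i, u i ∈ U) → f (Fin.cons x u) ∈ U}

/-- The centralizer `C_L(A) = {c ∈ L ∣ [c,a,x₃,…,x_{n+2}] = 0 for all a ∈ A, xᵢ ∈ L}`. -/
def centralizer (f : AlternatingMap F L L (Fin (n + 2))) (A : Submodule F L) : Set L :=
  {c | ∀ a ∈ A, ∀ x : Fin n → L, f (Fin.cons c (Fin.cons a x)) = 0}

/-- `S` is a Cartan subalgebra of `L`: a nilpotent self-normalizing subalgebra. -/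
def IsCartan (f : AlternatingMap F L L (Fin (n + 2))) (S : Submodule F L) : Prop :=
  IsSubalg f S ∧ (∃ r, lcsIn f S r = ⊥) ∧ normalizer f S = (S : Set L)

/-- `U` is a subnormal subalgebra of `L`. -/
def IsSubnormal (f : AlternatingMap F L L (Fin (n + 2))) (U : Submodule F L) : Prop :=
  ∃ (r : ℕ) (C : ℕ → Submodule F L), C 0 = U ∧ C r = ⊤ ∧
    (∀ i ≤ r, IsSubalg f (C i)) ∧ ∀ i < r, IsIdealIn f (C i) (C (i + 1))

/-- An `A`-inner automorphism: a finite product of maps `1 + D(a,x₂,…,x_{n+1})`,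
`a ∈ A`, where `A` is an abelian embedded ideal. -/
def IsAInner (f : AlternatingMap F L L (Fin (n + 2))) (A : Submodule F L)
    (α : L →ₗ[F] L) : Prop :=
  ∃ (m : ℕ) (g : Fin m → (L →ₗ[F] L)),
    (∀ j, ∃ (a : L) (x : Fin n → L), a ∈ A ∧ g j = LinearMap.id + D f (Fin.cons a x)) ∧
    α = (List.ofFn g).prod


/-- Moving the first entry of the bracket to the last slot changes it at most by a sign. -/
theorem exists_units_cons_eq_smul_snoc (f : AlternatingMap F L L (Fin (n + 2))) :
    ∃ c : ℤˣ, ∀ (x : L) (u : Fin (n + 1) → L), f (Fin.cons x u) = c • f (Fin.snoc u x) := by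
  refine ⟨Equiv.Perm.sign (finRotate (n + 2)), fun x u => ?_⟩
  have h1 : (Fin.snoc u x : Fin (n + 2) → L)
      = (Fin.cons x u : Fin (n + 2) → L) ∘ finRotate (n + 2) := by
    funext i
    exact congrFun (Fin.snoc_eq_cons_rotate u x) i
  rw [h1, f.map_perm, smul_smul, Int.units_mul_self, one_smul]

theorem cons_mem_iff_snoc_mem (f : AlternatingMap F L L (Fin (n + 2))) (S : Submodule F L)
    (x : L) (u : Fin (n + 1) → L) : f (Fin.cons x u) ∈ S ↔ f (Fin.snoc u x) ∈ S := by
  obtain ⟨c, hc⟩ := exists_units_cons_eq_smul_snoc f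
  rw [hc]
  rcases Int.units_eq_one_or c with rfl | rfl <;> simp

theorem isDerivation_of_mem_Dspan {f : AlternatingMap F L L (Fin (n + 2))} (hf : IsNLie f)
    {U : Submodule F L} {d : L →ₗ[F] L} (hd : d ∈ Dspan f U) : IsDerivation f d := by
  induction hd using Submodule.span_induction with
  | mem d hd =>
    obtain ⟨a, -, rfl⟩ := hd
    exact fun x => hf a x
  | zero =>
    intro x
    simp [AlternatingMap.map_update_zero]
  | add d e _ _ hd he =>
    intro x
    simp [AlternatingMap.map_update_add, Finset.sum_add_distrib, hd x, he x]
  | smul c d _ hd =>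
    intro x
    simp [AlternatingMap.map_update_smul, Finset.smul_sum, hd x]

theorem map_mem_of_mem_Dspan {f : AlternatingMap F L L (Fin (n + 2))} {U : Submodule F L}
    {V W : Submodule F L}
    (h : ∀ u : Fin (n + 1) → L, (∀ i, u i ∈ U) → ∀ x ∈ V, f (Fin.snoc u x) ∈ W)
    {d : L →ₗ[F] L} (hd : d ∈ Dspan f U) {x : L} (hx : x ∈ V) : d x ∈ W := by
  induction hd using Submodule.span_induction with
  | mem d hd =>
    obtain ⟨a, ha, rfl⟩ := hd
    exact h a ha x hx
  | zero => exact W.zero_mem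
  | add d e _ _ hd he => exact W.add_mem hd he
  | smul c d _ hd => exact W.smul_mem c hd

theorem IsSubalg.map_mem {f : AlternatingMap F L L (Fin (n + 2))} {U : Submodule F L}
    (hU : IsSubalg f U) {d : L →ₗ[F] L} (hd : d ∈ Dspan f U) {x : L} (hx : x ∈ U) :
    d x ∈ U := by
  refine map_mem_of_mem_Dspan (V := U) (fun u hu y hy => hU _ fun i => ?_) hd hx
  induction i using Fin.lastCases with
  | last => simpa using hy
  | cast i => simpa using hu i

/-- The Engel subspace of a derivation is a subalgebra. -/
theorem isSubalg_engel {f : AlternatingMap F L L (Fin (n + 2))} {d : L →ₗ[F] L}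
    (hd : IsDerivation f d) : IsSubalg f (engel d) := by
  have key : ∀ (m : ℕ) (r : Fin (n + 2) → ℕ) (x : Fin (n + 2) → L), ∑ i, r i = m →
      (∀ i, (d ^ r i) (x i) = 0) → f x ∈ engel d := by
    intro m
    induction m with
    | zero =>
      intro r x hr hx
      have h0 : r 0 = 0 := Finset.sum_eq_zero_iff.mp hr 0 (Finset.mem_univ _)
      have hx0 := hx 0
      rw [h0] at hx0
      rw [f.map_coord_zero 0 (by simpa using hx0)]
      exact (engel d).zero_mem
    | succ m ih =>
      intro r x hr hx
      by_cases hz : ∃ i, r i = 0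
      · obtain ⟨i, hi⟩ := hz
        have hxi := hx i
        rw [hi] at hxi
        rw [f.map_coord_zero i (by simpa using hxi)]
        exact (engel d).zero_mem
      · push Not at hz
        have hdx : d (f x) ∈ engel d := by
          rw [hd x]
          refine Submodule.sum_mem _ fun i _ => ?_
          refine ih (Function.update r i (r i - 1)) _ ?_ fun j => ?_
          · have h1 := Finset.sum_update_of_mem (Finset.mem_univ i) r (r i - 1)
            have h2 := Finset.add_sum_erase Finset.univ r (Finset.mem_univ i)
            rw [Finset.sdiff_singleton_eq_erase] at h1
            have := hz i
            omega
          · by_cases hj : j = i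
            · subst hj
              have h3 := hx j
              rw [← Nat.succ_pred_eq_of_ne_zero (hz j), pow_succ] at h3
              simpa using h3
            · simpa [hj] using hx j
        obtain ⟨s, hs⟩ := hdx
        exact ⟨s + 1, by rw [pow_succ]; exact hs⟩
  intro a ha
  choose r hr using ha
  exact key _ r a rfl hr

/-- A subalgebra which together with the Frattini subalgebra spans `L` is `L` itself. -/
theorem eq_top_of_sup_frattini [FiniteDimensional F L] {f : AlternatingMap F L L (Fin (n + 2))}
    {E : Submodule F L} (hE : IsSubalg f E) (h : E ⊔ frattini f = ⊤) : E = ⊤ := by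
  by_contra hne
  let S : Set (Submodule F L) := {M | IsSubalg f M ∧ E ≤ M ∧ M ≠ ⊤}
  obtain ⟨M, ⟨hM, hEM, hMtop⟩, hmax⟩ :=
    (wellFounded_gt (α := Submodule F L)).has_min S ⟨E, hE, le_rfl, hne⟩
  have hMmax : IsMaximalSubalg f M := by
    refine ⟨hM, hMtop, fun V hV hMV => ?_⟩
    by_contra hVtop
    exact hmax V ⟨hV, hEM.trans hMV.le, hVtop⟩ hMV
  exact hMtop (top_le_iff.mp (h ▸ sup_le hEM (sInf_le hMmax)))

/-- A derivation with a power mapping `L` into the Frattini subalgebra is nilpotent. -/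
theorem isNilpotent_of_range_pow_le_frattini [FiniteDimensional F L]
    {f : AlternatingMap F L L (Fin (n + 2))} {d : L →ₗ[F] L} (hd : IsDerivation f d) {N : ℕ}
    (hN : ∀ x, (d ^ N) x ∈ frattini f) : IsNilpotent d := by
  obtain ⟨M, hM, hNM⟩ :=
    (d.eventually_isCompl_ker_pow_range_pow.and (Filter.eventually_ge_atTop N)).exists
  have htop : engel d = ⊤ := by
    refine eq_top_of_sup_frattini (isSubalg_engel hd) (top_le_iff.mp ?_)
    rw [← hM.sup_eq_top]
    refine sup_le_sup (fun x hx => ⟨M, hx⟩) ?_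
    rintro _ ⟨x, rfl⟩
    rw [← Nat.add_sub_cancel' hNM, pow_add]
    exact hN _
  refine Module.End.isNilpotent_iff_of_finite.mpr fun x => ?_
  have hx : x ∈ engel d := htop ▸ Submodule.mem_top
  exact hx

theorem IsSubnormal.exists_pow_mem {f : AlternatingMap F L L (Fin (n + 2))}
    {U : Submodule F L} (hU : IsSubnormal f U) :
    ∃ r : ℕ, ∀ d ∈ Dspan f U, ∀ x, (d ^ r) x ∈ U := by
  obtain ⟨r, C, h0, hr, -, hC⟩ := hU
  have hUC : ∀ i ≤ r, U ≤ C i := by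
    intro i
    induction i with
    | zero => exact fun _ => h0.ge
    | succ i ih => exact fun hi => (ih (by omega)).trans (hC i (by omega)).1
  refine ⟨r, fun d hd x => ?_⟩
  have key : ∀ j ≤ r, (d ^ j) x ∈ C (r - j) := by
    intro j
    induction j with
    | zero => intro _; simp [hr]
    | succ j ih =>
      intro hj
      have hi := hC (r - (j + 1)) (by omega)
      rw [show r - (j + 1) + 1 = r - j by omega] at hi
      rw [pow_succ']
      refine map_mem_of_mem_Dspan (V := C (r - j)) (fun u hu y hy => ?_) hd (ih (by omega))
      refine hi.2 _ ?_ fun i => ?_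
      · have : (Fin.snoc u y : Fin (n + 2) → L) 0 = u 0 := by
          rw [← Fin.castSucc_zero, Fin.snoc_castSucc]
        rw [this]
        exact hUC _ (by omega) (hu 0)
      · induction i using Fin.lastCases with
        | last => simpa using hy
        | cast i => simpa using hUC _ (by omega) (hu i)
  simpa [h0] using key r le_rfl

theorem pow_mem_lcsMod {f : AlternatingMap F L L (Fin (n + 2))} {U : Submodule F L}
    (K : Submodule F L) {d : L →ₗ[F] L} (hd : d ∈ Dspan f U) {x : L} (hx : x ∈ U) (s : ℕ) :
    (d ^ s) x ∈ lcsMod f U K s := by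
  induction s with
  | zero => simpa [lcsMod] using hx
  | succ s ih =>
    rw [pow_succ']
    refine map_mem_of_mem_Dspan (V := lcsMod f U K s) (fun u hu y hy => ?_) hd ih
    rw [← cons_mem_iff_snoc_mem]
    refine Submodule.mem_sup_left (Submodule.subset_span ⟨_, fun i => ?_, rfl⟩)
    induction i using Fin.cases with
    | zero => simpa using hy
    | succ i => simpa using hu i

section InnerDerivations

attribute [local instance] LieRing.ofAssociativeRing

theorem IsDerivation.lie_D {f : AlternatingMap F L L (Fin (n + 2))} {d : Module.End F L}
    (hd : IsDerivation f d) (a : Fin (n + 1) → L) :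
    ⁅d, (D f a : Module.End F L)⁆ = ∑ i, D f (Function.update a i (d (a i))) := by
  ext x
  have h := hd (Fin.snoc a x)
  rw [Fin.sum_univ_castSucc] at h
  simp only [Fin.snoc_castSucc, Fin.snoc_last, Fin.update_snoc_last, ← Fin.snoc_update] at h
  rw [Ring.lie_def, LinearMap.sub_apply, Module.End.mul_apply, Module.End.mul_apply,
    LinearMap.sum_apply]
  exact sub_eq_of_eq_add h

theorem lie_mem_Dspan {f : AlternatingMap F L L (Fin (n + 2))} (hf : IsNLie f)
    {U : Submodule F L} (hU : IsSubalg f U) {d e : Module.End F L} (hd : d ∈ Dspan f U)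
    (he : e ∈ Dspan f U) : ⁅d, e⁆ ∈ Dspan f U := by
  induction he using Submodule.span_induction with
  | mem e he =>
    obtain ⟨a, ha, rfl⟩ := he
    rw [(isDerivation_of_mem_Dspan hf hd).lie_D]
    refine Submodule.sum_mem _ fun i _ => Submodule.subset_span ⟨_, fun j => ?_, rfl⟩
    by_cases hj : j = i
    · subst hj
      simpa using hU.map_mem hd (ha j)
    · simpa [hj] using ha j
  | zero => rw [lie_zero]; exact Submodule.zero_mem _
  | add e e' _ _ he he' => rw [lie_add]; exact Submodule.add_mem _ he he'
  | smul c e _ he => rw [lie_smul]; exact Submodule.smul_mem _ c he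

/-- `D(U)` as a Lie algebra of endomorphisms of `L`, for a subalgebra `U`. -/
def innerDerivations {f : AlternatingMap F L L (Fin (n + 2))} (hf : IsNLie f)
    {U : Submodule F L} (hU : IsSubalg f U) : LieSubalgebra F (Module.End F L) :=
  { Dspan f U with lie_mem' := fun hd he => lie_mem_Dspan hf hU hd he }

/-- Engel's theorem: a subalgebra acting on `L` by nilpotent operators is nilpotent. -/
theorem exists_lcsIn_eq_bot [FiniteDimensional F L] {f : AlternatingMap F L L (Fin (n + 2))}
    (hf : IsNLie f) {U : Submodule F L} (hU : IsSubalg f U)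
    (hnil : ∀ d ∈ Dspan f U, IsNilpotent d) : ∃ r, lcsIn f U r = ⊥ := by
  let H := innerDerivations hf hU
  have hN : LieModule.IsNilpotent H L := by
    rw [LieModule.isNilpotent_iff_forall (R := F)]
    exact fun d => hnil _ d.2
  obtain ⟨k, hk⟩ := (LieModule.isNilpotent_iff F H L).mp hN
  have key : ∀ s, lcsIn f U s ≤ (LieModule.lowerCentralSeries F H L s).toSubmodule := by
    intro s
    induction s with
    | zero => simp
    | succ s ih =>
      refine Submodule.span_le.mpr ?_
      rintro _ ⟨a, ha, rfl⟩
      rw [← Fin.cons_self_tail a, SetLike.mem_coe, cons_mem_iff_snoc_mem]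
      have hmem : D f (Fin.tail a) ∈ H :=
        Submodule.subset_span ⟨_, fun i => by simpa [Fin.tail] using ha i.succ, rfl⟩
      rw [LieModule.lowerCentralSeries_succ]
      exact LieSubmodule.lie_mem_lie (x := (⟨_, hmem⟩ : H)) (LieSubmodule.mem_top _)
        (ih (by simpa using ha 0))
  exact ⟨k, le_bot_iff.mp ((key k).trans (by simp [hk]))⟩

end InnerDerivations

/-- If `U` is a subnormal subalgebra of `L`, `K` an ideal of `U` with
`K ⊆ Φ(L)` and `U/K` nilpotent, then `U` is nilpotent. -/
theorem stmt4 {F : Type*} [Field F] {L : Type*} [AddCommGroup L] [Module F L]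
    [FiniteDimensional F L] {n : ℕ} (f : AlternatingMap F L L (Fin (n + 2)))
    (hf : IsNLie f) (U K : Submodule F L)
    (hU : IsSubalg f U) (hsub : IsSubnormal f U) (hK : IsIdealIn f K U)
    (hKPhi : K ≤ frattini f) (hquot : ∃ r, lcsMod f U K r ≤ K) :
    ∃ r, lcsIn f U r = ⊥ := by
  obtain ⟨r, hr⟩ := hsub.exists_pow_mem
  obtain ⟨s, hs⟩ := hquot
  refine exists_lcsIn_eq_bot hf hU fun d hd => ?_
  refine isNilpotent_of_range_pow_le_frattini (isDerivation_of_mem_Dspan hf hd) (N := s + r)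
    fun x => hKPhi (hs ?_)
  rw [pow_add]
  exact pow_mem_lcsMod K hd (hr d hd x) s

end NLie
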